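/- Let n ≥ 1 and let σ ⊆ Fin (n+1) be a subset not containing the last index n+1, with m := |σ| ≥ 2. For q ∈ ℤ^{n+1} set w(q) = Σ_{i∈σ} q_i − m · q_{n+1}. Let G be the smallest subset of ℤ^{n+1} that contains {q ∈ ℤ^{n+1} : 0 ≤ w(q) ≤ m−1} and has the following closure property: for every q ∈ ℤ^{n+1} and every J₀ ⊆ σ, if q − χ_J ∈ G for every subset J ⊆ σ with J ≠ J₀, then also q − χ_{J₀} ∈ G. Then G = ℤ^{n+1}. -/

import Mathlib

/-- `χ_J`, the indicator function of `J ⊆ Fin m`, valued in `ℤ`. -/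
def chi {m : ℕ} (J : Finset (Fin m)) : Fin m → ℤ :=
  fun i => if i ∈ J then 1 else 0

/-- with `w(q) = Σ_{i∈σ} q_i − m·q_{n+1}` (`m = |σ| ≥ 2`, `n+1 ∉ σ`),
any subset `G ⊆ ℤ^{n+1}` containing `{q : 0 ≤ w(q) ≤ m−1}` and closed under the rule
"if `q − χ_J ∈ G` for every `J ⊆ σ` with `J ≠ J₀`, then `q − χ_{J₀} ∈ G`"
is all of `ℤ^{n+1}`; hence the smallest such subset is `ℤ^{n+1}`. -/
theorem stmt10 (n : ℕ) (hn : 1 ≤ n) (σ : Finset (Fin (n + 1)))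
    (hlast : Fin.last n ∉ σ) (hm : 2 ≤ σ.card)
    (G : Set (Fin (n + 1) → ℤ))
    (hbase : ∀ q : Fin (n + 1) → ℤ,
      0 ≤ (∑ i ∈ σ, q i) - (σ.card : ℤ) * q (Fin.last n) ∧
        (∑ i ∈ σ, q i) - (σ.card : ℤ) * q (Fin.last n) ≤ (σ.card : ℤ) - 1 →
      q ∈ G)
    (hclose : ∀ q : Fin (n + 1) → ℤ, ∀ J₀ : Finset (Fin (n + 1)), J₀ ⊆ σ →
      (∀ J : Finset (Fin (n + 1)), J ⊆ σ → J ≠ J₀ → q - chi J ∈ G) →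
      q - chi J₀ ∈ G) :
    G = Set.univ := by
  have hw : ∀ (q : Fin (n + 1) → ℤ) (J : Finset (Fin (n + 1))), J ⊆ σ →
      (∑ i ∈ σ, (q - chi J) i) - (σ.card : ℤ) * (q - chi J) (Fin.last n)
        = (∑ i ∈ σ, q i) - (σ.card : ℤ) * q (Fin.last n) - (J.card : ℤ) := by
    intro q J hJ
    have h1 : chi J (Fin.last n) = 0 := by
      simp only [chi]
      rw [if_neg (fun h => hlast (hJ h))]
    have h2 : ∑ i ∈ σ, chi J i = (J.card : ℤ) := by
      simp only [chi]
      rw [Finset.sum_ite_mem, Finset.inter_eq_right.mpr hJ]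
      simp
    simp only [Pi.sub_apply, Finset.sum_sub_distrib, h1, h2]
    ring
  have key : ∀ (k : ℕ) (q : Fin (n + 1) → ℤ),
      -(k : ℤ) ≤ (∑ i ∈ σ, q i) - (σ.card : ℤ) * q (Fin.last n) →
      (∑ i ∈ σ, q i) - (σ.card : ℤ) * q (Fin.last n) ≤ (σ.card : ℤ) - 1 + k → q ∈ G := by
    intro k
    induction k with
    | zero =>
      intro q h1 h2
      exact hbase q ⟨by simpa using h1, by simpa using h2⟩
    | succ k ih =>
      intro q h1 h2
      push_cast at h1 h2
      by_cases ha : (∑ i ∈ σ, q i) - (σ.card : ℤ) * q (Fin.last n) < -(k : ℤ)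
      · have hq : q = (q + chi σ) - chi σ := by simp
        have hs := hw (q + chi σ) σ subset_rfl
        rw [← hq] at hs
        rw [hq]
        apply hclose _ _ subset_rfl
        intro J hJ hne
        have hlt : J.card < σ.card := Finset.card_lt_card (hJ.ssubset_of_ne hne)
        have hJ' := hw (q + chi σ) J hJ
        apply ih <;> rw [hJ'] <;> linarith [(Nat.cast_nonneg J.card : (0 : ℤ) ≤ J.card),
          (by exact_mod_cast hlt : (J.card : ℤ) + 1 ≤ σ.card)]
      · by_cases hb : (∑ i ∈ σ, q i) - (σ.card : ℤ) * q (Fin.last n) ≤ (σ.card : ℤ) - 1 + k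
        · exact ih q (by linarith) hb
        · have hq : q = q - chi ∅ := by
            funext i
            simp [chi]
          rw [hq]
          apply hclose _ _ (Finset.empty_subset _)
          intro J hJ hne
          have hle : J.card ≤ σ.card := Finset.card_le_card hJ
          have hpos : 0 < J.card := Finset.card_pos.mpr (Finset.nonempty_iff_ne_empty.mpr hne)
          have hJ' := hw q J hJ
          apply ih <;> rw [hJ'] <;> omega
  ext q
  simp only [Set.mem_univ, iff_true]
  apply key ((∑ i ∈ σ, q i) - (σ.card : ℤ) * q (Fin.last n)).natAbs q <;> omega
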